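/- Let X be a finite subset of ℝ^n and k ≥ 0 an integer. Then every element a of Γ_k(X) has a maximal branch point below it: a branch point b with b ≼ a such that b' ≼ b for every branch point b' with b' ≼ a. -/

import Mathlib

open scoped Classical

noncomputable section

namespace DataHomotopy

/-- Points of `ℝ^n` with the Euclidean metric. -/
abbrev Pt (n : ℕ) := EuclideanSpace ℝ (Fin n)

/-- `σ` is a simplex of the Vietoris–Rips complex `V_s(X)`: a nonempty subset of `X`
all of whose pairwise distances are at most `s`. -/
def IsVRSimplex {n : ℕ} (X : Finset (Pt n)) (s : ℝ) (σ : Finset (Pt n)) : Prop :=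
  σ.Nonempty ∧ σ ⊆ X ∧ ∀ x ∈ σ, ∀ y ∈ σ, dist x y ≤ s

/-- `x` is a vertex of the Lesnick complex `L_{s,k}(X)`: `x ∈ X` and there are at least
`k` points of `X`, distinct from `x`, within distance `s` of `x`. -/
def IsLVertex {n : ℕ} (X : Finset (Pt n)) (k : ℕ) (s : ℝ) (x : Pt n) : Prop :=
  x ∈ X ∧ ∃ S : Finset (Pt n), S ⊆ X ∧ x ∉ S ∧ k ≤ S.card ∧ ∀ x' ∈ S, dist x x' ≤ s

/-- `σ` is a simplex of the Lesnick complex `L_{s,k}(X)`: a Vietoris–Rips simplex all of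
whose elements are vertices of `L_{s,k}(X)`. -/
def IsLSimplex {n : ℕ} (X : Finset (Pt n)) (k : ℕ) (s : ℝ) (σ : Finset (Pt n)) : Prop :=
  IsVRSimplex X s σ ∧ ∀ x ∈ σ, IsLVertex X k s x

/-- `x` and `y` lie in the same component of `L_{s,k}(X)`: both are vertices, and they are
joined by a finite chain of vertices with consecutive distances at most `s`. -/
def SameComp {n : ℕ} (X : Finset (Pt n)) (k : ℕ) (s : ℝ) (x y : Pt n) : Prop :=
  IsLVertex X k s x ∧
    Relation.ReflTransGen (fun a b => IsLVertex X k s b ∧ dist a b ≤ s) x y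

/-- `p = (s, x)` is an element of `Γ_k(X)`: `s ≥ 0` and `x` is a vertex of `L_{s,k}(X)`. -/
def InGamma {n : ℕ} (X : Finset (Pt n)) (k : ℕ) (p : ℝ × Pt n) : Prop :=
  0 ≤ p.1 ∧ IsLVertex X k p.1 p.2

/-- The preorder on `Γ_k(X)`: `(s, x) ≼ (t, y)` iff `s ≤ t` and `x`, `y` lie in the same
component of `L_{t,k}(X)`. -/
def GammaLe {n : ℕ} (X : Finset (Pt n)) (k : ℕ) (p q : ℝ × Pt n) : Prop :=
  p.1 ≤ q.1 ∧ SameComp X k q.1 p.2 q.2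

/-- `p = (t, x)` is a branch point of `Γ_k(X)`. -/
def IsBranch {n : ℕ} (X : Finset (Pt n)) (k : ℕ) (p : ℝ × Pt n) : Prop :=
  InGamma X k p ∧
    ((∃ s₀, s₀ < p.1 ∧ ∀ s, s₀ ≤ s → s < p.1 →
        ∃ x₀ x₁ : Pt n, IsLVertex X k s x₀ ∧ IsLVertex X k s x₁ ∧
          ¬ SameComp X k s x₀ x₁ ∧ GammaLe X k (s, x₀) p ∧ GammaLe X k (s, x₁) p) ∨
      ¬ ∃ q : ℝ × Pt n, q.1 < p.1 ∧ InGamma X k q ∧ GammaLe X k q p)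

/-- `c` is a least upper bound of `a` and `b` in `Γ_k(X)`. -/
def IsLUBIn {n : ℕ} (X : Finset (Pt n)) (k : ℕ) (a b c : ℝ × Pt n) : Prop :=
  InGamma X k c ∧ GammaLe X k a c ∧ GammaLe X k b c ∧
    ∀ c', InGamma X k c' → GammaLe X k a c' → GammaLe X k b c' → GammaLe X k c c'

/-- `b` is a maximal branch point below `a` in `Γ_k(X)`. -/
def IsMaxBranchBelow {n : ℕ} (X : Finset (Pt n)) (k : ℕ) (b a : ℝ × Pt n) : Prop :=
  IsBranch X k b ∧ GammaLe X k b a ∧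
    ∀ b', IsBranch X k b' → GammaLe X k b' a → GammaLe X k b' b

/-- The Euclidean distance on `(ℝ^n)^m ≅ ℝ^{nm}` between two `m`-tuples. -/
def tupleDist {n m : ℕ} (y x : Fin m → Pt n) : ℝ :=
  Real.sqrt (∑ i, dist (y i) (x i) ^ 2)

/-- `X^m_dis` is `r`-dense in `Y^m_dis`: every `m`-tuple of pairwise distinct points of `Y`
is within distance `< r` (in `ℝ^{nm}`) of an `m`-tuple of pairwise distinct points of `X`. -/
def ConfigDense {n : ℕ} (X Y : Finset (Pt n)) (m : ℕ) (r : ℝ) : Prop :=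
  ∀ y : Fin m → Pt n, (∀ i, y i ∈ Y) → Function.Injective y →
    ∃ x : Fin m → Pt n, (∀ i, x i ∈ X) ∧ Function.Injective x ∧ tupleDist y x < r

/-- `s` and `t` are consecutive phase-change numbers of `Y`: both are realized as distances
between points of `Y`, `s < t`, and no distance between points of `Y` lies strictly
between `s` and `t`. -/
def IsPhasePair {n : ℕ} (Y : Finset (Pt n)) (s t : ℝ) : Prop :=
  (∃ a ∈ Y, ∃ b ∈ Y, dist a b = s) ∧ (∃ a ∈ Y, ∃ b ∈ Y, dist a b = t) ∧
    s < t ∧ ∀ a ∈ Y, ∀ b ∈ Y, dist a b ≤ s ∨ t ≤ dist a b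

/-- `dS X k s x y = u - s`, where `u` is the least number `u ≥ s` such that `x` and `y`
lie in the same component of `L_{u,k}(X)`. -/
def dS {n : ℕ} (X : Finset (Pt n)) (k : ℕ) (s : ℝ) (x y : Pt n) : ℝ :=
  sInf {u : ℝ | s ≤ u ∧ SameComp X k u x y} - s

section Lesnick

variable {n k : ℕ} {X : Finset (Pt n)} {s t r : ℝ} {x y z : Pt n}

theorem IsLVertex.of_dist_le (hd : ∀ p ∈ X, ∀ q ∈ X, dist p q ≤ s → dist p q ≤ t)
    (h : IsLVertex X k s x) : IsLVertex X k t x := by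
  obtain ⟨hx, S, hS, hxS, hk, hdist⟩ := h
  exact ⟨hx, S, hS, hxS, hk, fun y hy => hd x hx y (hS hy) (hdist y hy)⟩

theorem IsLVertex.mono (hst : s ≤ t) (h : IsLVertex X k s x) : IsLVertex X k t x :=
  h.of_dist_le fun _ _ _ _ h' => h'.trans hst

theorem SameComp.refl (h : IsLVertex X k s x) : SameComp X k s x x :=
  ⟨h, .refl⟩

theorem SameComp.right (h : SameComp X k s x y) : IsLVertex X k s y := by
  obtain ⟨hx, h⟩ := h
  induction h with
  | refl => exact hx
  | tail _ h _ => exact h.1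

theorem SameComp.trans (h : SameComp X k s x y) (h' : SameComp X k s y z) :
    SameComp X k s x z :=
  ⟨h.1, h.2.trans h'.2⟩

theorem SameComp.symm (h : SameComp X k s x y) : SameComp X k s y x := by
  obtain ⟨hx, h⟩ := h
  induction h with
  | refl => exact .refl hx
  | tail h' h ih => exact .trans ⟨h.1, .single ⟨ih.1, by rw [dist_comm]; exact h.2⟩⟩ ih

theorem SameComp.of_dist_le (hd : ∀ p ∈ X, ∀ q ∈ X, dist p q ≤ s → dist p q ≤ t)
    (h : SameComp X k s x y) : SameComp X k t x y := by
  obtain ⟨hx, h⟩ := h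
  induction h with
  | refl => exact .refl (hx.of_dist_le hd)
  | tail h' h ih =>
    exact ih.trans ⟨ih.right, .single ⟨h.1.of_dist_le hd, hd _ ih.right.1 _ h.1.1 h.2⟩⟩

theorem SameComp.mono (hst : s ≤ t) (h : SameComp X k s x y) : SameComp X k t x y :=
  h.of_dist_le fun _ _ _ _ h' => h'.trans hst

theorem exists_forall_dist_le_right (X : Finset (Pt n)) (t : ℝ) :
    ∃ u > t, ∀ s ∈ Set.Ico t u, ∀ p ∈ X, ∀ q ∈ X, dist p q ≤ s ↔ dist p q ≤ t := by
  have h : ∀ᶠ u in nhdsWithin t (Set.Ioi t), ∀ p ∈ X, ∀ q ∈ X, t < dist p q → u < dist p q := by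
    simp only [Filter.eventually_all_finset]
    intro p _ q _
    by_cases hpq : t < dist p q
    · filter_upwards [mem_nhdsWithin_of_mem_nhds (Iio_mem_nhds hpq)] with u hu _ using hu
    · simp [hpq]
  obtain ⟨u, hu, htu⟩ := (h.and self_mem_nhdsWithin).exists
  refine ⟨u, htu, fun s hs p hp q hq => ⟨fun h => ?_, fun h => h.trans hs.1⟩⟩
  by_contra! hlt
  exact absurd (hu p hp q hq hlt) (by linarith [hs.2])

theorem exists_forall_dist_le_left (X : Finset (Pt n)) (t : ℝ) :
    ∃ u < t, ∀ s ∈ Set.Ico u t, ∀ p ∈ X, ∀ q ∈ X, dist p q ≤ s ↔ dist p q < t := by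
  have h : ∀ᶠ u in nhdsWithin t (Set.Iio t), ∀ p ∈ X, ∀ q ∈ X, dist p q < t → dist p q < u := by
    simp only [Filter.eventually_all_finset]
    intro p _ q _
    by_cases hpq : dist p q < t
    · filter_upwards [mem_nhdsWithin_of_mem_nhds (Ioi_mem_nhds hpq)] with u hu _ using hu
    · simp [hpq]
  obtain ⟨u, hu, htu⟩ := (h.and self_mem_nhdsWithin).exists
  exact ⟨u, htu, fun s hs p hp q hq =>
    ⟨fun h => h.trans_lt hs.2, fun h => (hu p hp q hq h).le.trans hs.1⟩⟩

/-- The vertices of `L_{s,k}(X)` lying in the component of `y` in `L_{r,k}(X)` form a single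
component of `L_{s,k}(X)`. -/
def UniqueCompBelow (X : Finset (Pt n)) (k : ℕ) (r : ℝ) (y : Pt n) (s : ℝ) : Prop :=
  (∃ x, IsLVertex X k s x ∧ SameComp X k r x y) ∧
    ∀ x₀ x₁, IsLVertex X k s x₀ → IsLVertex X k s x₁ → SameComp X k r x₀ y →
      SameComp X k r x₁ y → SameComp X k s x₀ x₁

theorem UniqueCompBelow.self (h : IsLVertex X k r y) : UniqueCompBelow X k r y r :=
  ⟨⟨y, h, .refl h⟩, fun _ _ _ _ h₀ h₁ => h₀.trans h₁.symm⟩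

theorem UniqueCompBelow.congr (hd : ∀ p ∈ X, ∀ q ∈ X, dist p q ≤ s ↔ dist p q ≤ t)
    (h : UniqueCompBelow X k r y s) : UniqueCompBelow X k r y t := by
  have hst : ∀ p ∈ X, ∀ q ∈ X, dist p q ≤ s → dist p q ≤ t := fun p hp q hq => (hd p hp q hq).1
  have hts : ∀ p ∈ X, ∀ q ∈ X, dist p q ≤ t → dist p q ≤ s := fun p hp q hq => (hd p hp q hq).2
  obtain ⟨⟨x, hx, hxy⟩, h⟩ := h
  exact ⟨⟨x, hx.of_dist_le hst, hxy⟩, fun x₀ x₁ h₀ h₁ c₀ c₁ =>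
    (h x₀ x₁ (h₀.of_dist_le hts) (h₁.of_dist_le hts) c₀ c₁).of_dist_le hst⟩

/-- There is a least scale from which on the part of `L_{s,k}(X)` below `(r, y)` is connected. -/
theorem exists_isLeast_uniqueCompBelow (hr : 0 ≤ r) (hy : IsLVertex X k r y) :
    ∃ t, IsLeast {s | 0 ≤ s ∧ s ≤ r ∧ ∀ u ∈ Set.Icc s r, UniqueCompBelow X k r y u} t := by
  set A := {s | 0 ≤ s ∧ s ≤ r ∧ ∀ u ∈ Set.Icc s r, UniqueCompBelow X k r y u}
  have hne : A.Nonempty := ⟨r, hr, le_rfl, fun u hu => by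
    rw [le_antisymm hu.2 hu.1]; exact .self hy⟩
  have hbdd : BddBelow A := ⟨0, fun s hs => hs.1⟩
  refine ⟨sInf A, ⟨le_csInf hne fun s hs => hs.1, ?_, fun u hu => ?_⟩, fun s hs => csInf_le hbdd hs⟩
  · obtain ⟨s, hs⟩ := hne
    exact (csInf_le hbdd hs).trans hs.2.1
  · obtain ⟨v, hv, hd⟩ := exists_forall_dist_le_right X u
    obtain ⟨s, hs, hsv⟩ := exists_lt_of_csInf_lt hne (hu.1.trans_lt hv)
    rcases le_total s u with hsu | hus
    · exact hs.2.2 u ⟨hsu, hu.2⟩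
    · exact (hs.2.2 s ⟨le_rfl, hs.2.1⟩).congr (hd s ⟨hus, hsv⟩)

end Lesnick

theorem stmt12 {n : ℕ} (X : Finset (Pt n)) (k : ℕ)
    (a : ℝ × Pt n) (ha : InGamma X k a) :
    ∃ b : ℝ × Pt n, IsMaxBranchBelow X k b a := by
  obtain ⟨r, y⟩ := a
  obtain ⟨t, ⟨ht0, htr, hP⟩, hmin⟩ := exists_isLeast_uniqueCompBelow ha.1 ha.2
  dsimp only at htr hP hmin
  have hPt := hP t ⟨le_rfl, htr⟩
  obtain ⟨x, hx, hxy⟩ := hPt.1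
  refine ⟨(t, x), ⟨⟨ht0, hx⟩, ?_⟩, ⟨htr, hxy⟩, ?_⟩
  · by_cases hq : ∃ q : ℝ × Pt n, q.1 < t ∧ InGamma X k q ∧ GammaLe X k q (t, x)
    · left
      obtain ⟨⟨v, z⟩, hvt, ⟨hv0, hz⟩, -, hzx⟩ := hq
      dsimp only at hvt hv0 hz hzx
      obtain ⟨u, hut, hd⟩ := exists_forall_dist_le_left X t
      refine ⟨max v u, max_lt hvt hut, fun s hs hst => ?_⟩
      dsimp only at hst
      have hvs := (le_max_left v u).trans hs
      have hus := (le_max_right v u).trans hs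
      have hnot : ¬ UniqueCompBelow X k r y s := fun hPs => by
        refine (hmin ⟨hv0.trans hvs, hst.le.trans htr, fun w hw => ?_⟩).not_gt hst
        rcases lt_or_ge w t with hwt | htw
        · exact hPs.congr fun p hp q hq =>
            (hd s ⟨hus, hst⟩ p hp q hq).trans (hd w ⟨hus.trans hw.1, hwt⟩ p hp q hq).symm
        · exact hP w ⟨htw, hw.2⟩
      have hzy : SameComp X k r z y := (hzx.mono htr).trans hxy
      simp only [UniqueCompBelow, not_and, not_forall] at hnot
      obtain ⟨x₀, x₁, h₀, h₁, c₀, c₁, hne⟩ := hnot ⟨z, hz.mono hvs, hzy⟩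
      exact ⟨x₀, x₁, h₀, h₁, hne, ⟨hst.le, hPt.2 x₀ x (h₀.mono hst.le) hx c₀ hxy⟩,
        ⟨hst.le, hPt.2 x₁ x (h₁.mono hst.le) hx c₁ hxy⟩⟩
    · exact .inr hq
  · rintro ⟨t', x'⟩ ⟨⟨ht'0, hx'⟩, hbr⟩ ⟨ht'r, hx'y⟩
    dsimp only at ht'0 hx' hbr ht'r hx'y
    rcases le_or_gt t' t with hle | hlt
    · exact ⟨hle, hPt.2 x' x (hx'.mono hle) hx hx'y hxy⟩
    · exfalso
      rcases hbr with ⟨s₀, hs₀, hbr⟩ | hbr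
      · obtain ⟨x₀, x₁, h₀, h₁, hne, ⟨-, c₀⟩, ⟨-, c₁⟩⟩ :=
          hbr (max s₀ t) (le_max_left _ _) (max_lt hs₀ hlt)
        have hle : max s₀ t ≤ r := (max_lt hs₀ hlt).le.trans ht'r
        exact hne ((hP _ ⟨le_max_right _ _, hle⟩).2 x₀ x₁ h₀ h₁
          ((c₀.mono ht'r).trans hx'y) ((c₁.mono ht'r).trans hx'y))
      · exact hbr ⟨(t, x), hlt, ⟨ht0, hx⟩, hlt.le,
          (hP t' ⟨hlt.le, ht'r⟩).2 x x' (hx.mono hlt.le) hx' hxy hx'y⟩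

end DataHomotopy
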